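/- arXiv:0811.3024 — 2 statements merged into one kernel-verified Lean document; each statement's English description precedes it below -/
import Mathlib

section
/- (Proposition 3, existence.) Fix an integer m ≥ 2, λ > 0, and a Borel probability measure μ₀ on ℝ whose moment generating function s ↦ ∫ e^{s x} dμ₀(x) is finite on a neighborhood of 0 and which has nonzero first moment ∫ x dμ₀(x) ≠ 0. Let b : ℕ → ℝ be defined by b(1) = 1 and, for n > 1, b(n) = (m−1)^{−1} ( 1 − Σ_{(i₁,…,i_{m−1}): each i_k < n, Σ i_k = n+m−2} ∏_{k=1}^{m−1} b(i_k) ). For t ≥ 0 define μ_t = Σ_{n≥1} b(n) e^{−λt}(1−e^{−(m−1)λt})^{n−1} μ₀^{*[(m−1)(n−1)+1]}. Then each μ_t is a Borel probability measure on ℝ and for every Borel set A ⊆ ℝ and t ≥ 0, μ_t(A) = μ₀(A) + λ ∫₀ᵗ ( μ_s^{*m}(A) − μ_s(A) ) ds. -/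
open MeasureTheory

/-- `n`-fold convolution power of a measure on `ℝ`: `convPow μ 0 = δ₀` and
`convPow μ (n+1) = (convPow μ n) ∗ μ`. In particular `convPow μ 1 = δ₀ ∗ μ = μ`. -/
noncomputable def convPow (μ : Measure ℝ) : ℕ → Measure ℝ
  | 0 => Measure.dirac 0
  | n + 1 => Measure.conv (convPow μ n) μ

theorem PowerSeries.mk_pow_eq_mk_one_of_recurrence {p : ℕ} (hp : p ≠ 0) {b : ℕ → ℝ} (hb1 : b 1 = 1)
    (hb : ∀ n > 1, b n = (p : ℝ)⁻¹ *
        (1 - ∑ i ∈ (Fintype.piFinset fun _ : Fin p => Finset.Ico 1 n).filter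
              (fun i => ∑ k, i k = n + p - 1), ∏ k, b (i k))) :
    PowerSeries.mk (fun n => b (n + 1)) ^ p = PowerSeries.mk 1 := by
  ext n
  have hprod : PowerSeries.mk (fun n => b (n + 1)) ^ p
      = ∏ _k : Fin p, PowerSeries.mk (fun n => b (n + 1)) := by simp
  rw [hprod, PowerSeries.coeff_prod]
  simp only [PowerSeries.coeff_mk, Pi.one_apply]
  rcases Nat.eq_zero_or_pos n with rfl | hn
  · simp [hb1]
  have hp' : (p : ℝ) ≠ 0 := by exact_mod_cast hp
  have hrec := hb (n + 1) (by lia)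
  have hreindex : ∑ i ∈ (Fintype.piFinset fun _ : Fin p => Finset.Ico 1 (n + 1)).filter
        (fun i => ∑ k, i k = n + 1 + p - 1), ∏ k, b (i k)
      = ∑ l ∈ ((Finset.univ : Finset (Fin p)).finsuppAntidiag n).filter (fun l => ∀ k, l k < n),
          ∏ k, b (l k + 1) := by
    refine Finset.sum_bij' (fun i _ => Finsupp.equivFunOnFinite.symm fun k => i k - 1)
      (fun l _ k => l k + 1) ?_ ?_ ?_ ?_ ?_
    · intro i hi
      simp only [Finset.mem_filter, Fintype.mem_piFinset, Finset.mem_Ico] at hi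
      have hsum : ∑ k, (i k - 1) + p = ∑ k, i k := by
        calc ∑ k, (i k - 1) + p = ∑ k : Fin p, ((i k - 1) + 1) := by
              simp [Finset.sum_add_distrib]
          _ = ∑ k, i k := Finset.sum_congr rfl fun k _ => by have := hi.1 k; lia
      simp only [Finset.mem_filter, Finset.mem_finsuppAntidiag, Finset.subset_univ, and_true,
        Finsupp.equivFunOnFinite_symm_apply_apply]
      exact ⟨by lia, fun k => by have := hi.1 k; lia⟩
    · intro l hl
      simp only [Finset.mem_filter, Finset.mem_finsuppAntidiag, Finset.subset_univ,
        and_true] at hl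
      simp only [Finset.mem_filter, Fintype.mem_piFinset, Finset.mem_Ico, Finset.sum_add_distrib,
        hl.1]
      exact ⟨fun k => by have := hl.2 k; lia, by simp⟩
    · intro i hi
      simp only [Finset.mem_filter, Fintype.mem_piFinset, Finset.mem_Ico] at hi
      funext k
      have := hi.1 k
      simp only [Finsupp.equivFunOnFinite_symm_apply_apply]
      lia
    · intro l hl
      ext k
      simp
    · intro i hi
      simp only [Finset.mem_filter, Fintype.mem_piFinset, Finset.mem_Ico] at hi
      refine Finset.prod_congr rfl fun k _ => ?_
      have := hi.1 k
      simp only [Finsupp.equivFunOnFinite_symm_apply_apply]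
      congr 1
      lia
  have hconc : ((Finset.univ : Finset (Fin p)).finsuppAntidiag n).filter
        (fun l => ¬ ∀ k, l k < n) = Finset.univ.image fun k => Finsupp.single k n := by
    ext l
    simp only [Finset.mem_filter, Finset.mem_finsuppAntidiag, Finset.subset_univ, and_true,
      Finset.mem_image, Finset.mem_univ, true_and, not_forall, not_lt]
    constructor
    · rintro ⟨hl, k, hk⟩
      refine ⟨k, ?_⟩
      have hsplit := Finset.add_sum_erase Finset.univ (fun j => l j) (Finset.mem_univ k)
      have hzero : ∑ j ∈ Finset.univ.erase k, l j = 0 := by lia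
      rw [Finset.sum_eq_zero_iff] at hzero
      ext j
      by_cases hj : j = k
      · subst hj
        simp only [Finsupp.single_eq_same]
        lia
      · simp [hj, hzero j (by simp [hj])]
    · rintro ⟨k, rfl⟩
      exact ⟨by simp [Finsupp.single_apply], k, by simp⟩
  have hval : ∑ l ∈ Finset.univ.image fun k : Fin p => Finsupp.single k n,
      ∏ k, b (l k + 1) = p * b (n + 1) := by
    rw [Finset.sum_image fun x _ y _ h => (Finsupp.single_left_inj hn.ne').1 h]
    have (x : Fin p) : ∏ k, b (Finsupp.single x n k + 1) = b (n + 1) := by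
      rw [Finset.prod_eq_single x]
      · simp
      · intro k _ hk
        simp [hk, hb1]
      · simp
    simp [this]
  rw [← Finset.sum_filter_add_sum_filter_not _ (fun l : Fin p →₀ ℕ => ∀ k, l k < n), hconc, hval,
    ← hreindex, hrec]
  field_simp
  ring

theorem PowerSeries.natCast_mul_derivative_eq_of_pow_eq_mk_one {p : ℕ} (hp : p ≠ 0)
    {B : PowerSeries ℝ} (hB : B ^ p = PowerSeries.mk 1) :
    (p : PowerSeries ℝ) * PowerSeries.derivative ℝ B = B * PowerSeries.mk 1 := by
  have hone : (PowerSeries.mk 1 : PowerSeries ℝ) ≠ 0 := fun h => by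
    simpa using congrArg (PowerSeries.coeff 0) h
  have hD : PowerSeries.derivative ℝ (PowerSeries.mk 1 : PowerSeries ℝ) = PowerSeries.mk 1 ^ 2 := by
    rw [PowerSeries.mk_one_pow_eq_mk_choose_add ℝ 1]
    ext n
    simp [PowerSeries.coeff_derivative]
    ring
  have h := congrArg (PowerSeries.derivative ℝ) hB
  rw [PowerSeries.derivative_pow, hD] at h
  apply mul_left_cancel₀ hone
  calc PowerSeries.mk 1 * ((p : PowerSeries ℝ) * PowerSeries.derivative ℝ B)
      = ((p : PowerSeries ℝ) * B ^ (p - 1) * PowerSeries.derivative ℝ B) * B := by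
        rw [← hB, ← pow_sub_one_mul hp B]; ring
    _ = _ := by rw [h]; ring

theorem PowerSeries.natCast_mul_coeff_succ_of_pow_eq_mk_one {p : ℕ} (hp : p ≠ 0)
    {B : PowerSeries ℝ} (hB : B ^ p = PowerSeries.mk 1) (n : ℕ) :
    p * ((n + 1) * coeff (n + 1) B) = coeff n (B ^ (p + 1)) ∧
      coeff n (B ^ (p + 1)) = ∑ k ∈ Finset.range (n + 1), coeff k B := by
  rw [pow_succ', hB]
  constructor
  · rw [← natCast_mul_derivative_eq_of_pow_eq_mk_one hp hB, ← map_natCast (C (R := ℝ)),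
      coeff_C_mul, coeff_derivative]
    ring
  · rw [coeff_mul, Finset.Nat.sum_antidiagonal_eq_sum_range_succ_mk]
    simp

theorem PowerSeries.coeff_mem_Icc_of_pow_eq_mk_one {p : ℕ} (hp : p ≠ 0)
    {B : PowerSeries ℝ} (hB : B ^ p = PowerSeries.mk 1) (hB0 : coeff 0 B = 1) (n : ℕ) :
    coeff n B ∈ Set.Icc (0 : ℝ) 1 := by
  induction n using Nat.strong_induction_on with
  | _ n ih =>
    cases n with
    | zero => simp [hB0]
    | succ n =>
      obtain ⟨h1, h2⟩ := natCast_mul_coeff_succ_of_pow_eq_mk_one hp hB n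
      rw [h2] at h1
      have hp1 : (1 : ℝ) ≤ p := by exact_mod_cast Nat.one_le_iff_ne_zero.2 hp
      have hpos : (0 : ℝ) < p * (n + 1) := by positivity
      have hlow : 0 ≤ ∑ k ∈ Finset.range (n + 1), coeff k B :=
        Finset.sum_nonneg fun k hk => (ih k (by simpa using hk)).1
      have hup : ∑ k ∈ Finset.range (n + 1), coeff k B ≤ n + 1 := by
        simpa using Finset.sum_le_card_nsmul (Finset.range (n + 1)) (fun k => coeff k B) 1
          fun k hk => (ih k (by simpa using hk)).2
      rw [← mul_assoc] at h1
      have hn : (0 : ℝ) < n + 1 := by positivity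
      constructor
      · by_contra! hneg
        nlinarith
      · by_contra! hgt
        nlinarith [mul_le_mul_of_nonneg_right hp1 hn.le]

theorem hasDerivAt_tsum_mul_pow {a : ℕ → ℝ} {k : ℕ} (ha : ∀ n, |a n| ≤ ((n : ℝ) + 1) ^ k) {z : ℝ}
    (hz : |z| < 1) :
    HasDerivAt (fun z => ∑' n, a n * z ^ n) (∑' n, (n + 1) * a (n + 1) * z ^ n) z := by
  obtain ⟨r, hzr, hr1⟩ := exists_between hz
  have hr0 : 0 ≤ r := (abs_nonneg z).trans hzr.le
  have hsum : Summable fun n : ℕ => ((n : ℝ) + 1) ^ (k + 1) * r ^ n := by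
    rcases hr0.eq_or_lt with rfl | hr
    · exact absurd hzr (not_lt.2 (abs_nonneg z))
    have h := (summable_nat_add_iff 1).2 (summable_pow_mul_geometric_of_norm_lt_one (R := ℝ) (k + 1)
      (r := r) (by rwa [Real.norm_of_nonneg hr0]))
    refine (h.mul_right r⁻¹).congr fun n => ?_
    push_cast
    field_simp
    ring
  have hbound : Summable fun n : ℕ => (n : ℝ) * ((n : ℝ) + 1) ^ k * r ^ (n - 1) := by
    rw [← summable_nat_add_iff 1]
    have h := (hsum.mul_left (2 ^ k))
    refine Summable.of_nonneg_of_le (fun n => by positivity) (fun n => ?_) h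
    have h2 : (((n + 1 : ℕ) : ℝ) + 1) ^ k ≤ 2 ^ k * ((n : ℝ) + 1) ^ k := by
      rw [← mul_pow]
      gcongr
      push_cast
      have : (0 : ℝ) ≤ n := n.cast_nonneg
      linarith
    calc ((n + 1 : ℕ) : ℝ) * (((n + 1 : ℕ) : ℝ) + 1) ^ k * r ^ (n + 1 - 1)
        ≤ ((n + 1 : ℕ) : ℝ) * (2 ^ k * ((n : ℝ) + 1) ^ k) * r ^ (n + 1 - 1) := by gcongr
      _ = _ := by rw [Nat.add_sub_cancel]; push_cast; ring
  have h := hasDerivAt_tsum_of_isPreconnected (g := fun n z => a n * z ^ n)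
    (g' := fun n z => a n * (n * z ^ (n - 1))) (t := Metric.ball (0 : ℝ) r) (y₀ := 0) (y := z)
    hbound Metric.isOpen_ball (convex_ball 0 r).isPreconnected
    (fun n y _ => (hasDerivAt_pow n y).const_mul (a n))
    (fun n y hy => ?_) (by simpa using (abs_nonneg z).trans_lt hzr)
    (summable_of_ne_finset_zero (s := {0}) fun n hn => by
      simp [show n ≠ 0 by simpa using hn]) (by simpa using hzr)
  · have hshift : ∑' n : ℕ, a n * (n * z ^ (n - 1)) = ∑' n : ℕ, (n + 1) * a (n + 1) * z ^ n := by
      have hs : Summable fun n : ℕ => a n * (n * z ^ (n - 1)) := by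
        refine Summable.of_norm_bounded hbound fun n => ?_
        rw [norm_mul, norm_mul, norm_pow, Real.norm_natCast, Real.norm_eq_abs, Real.norm_eq_abs]
        have := ha n
        calc |a n| * (n * |z| ^ (n - 1)) ≤ ((n : ℝ) + 1) ^ k * (n * r ^ (n - 1)) := by gcongr
          _ = _ := by ring
      rw [hs.tsum_eq_zero_add]
      simp only [CharP.cast_eq_zero, zero_mul, mul_zero, zero_add, Nat.add_sub_cancel]
      refine tsum_congr fun n => ?_
      push_cast
      ring
    exact hshift ▸ h
  · rw [norm_mul, norm_mul, norm_pow, Real.norm_natCast, Real.norm_eq_abs, Real.norm_eq_abs]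
    have := ha n
    have hy' : |y| ≤ r := by simpa using (Metric.mem_ball.1 hy).le
    calc |a n| * (n * |y| ^ (n - 1)) ≤ ((n : ℝ) + 1) ^ k * (n * r ^ (n - 1)) := by gcongr
      _ = _ := by ring

namespace MeasureTheory.Measure

theorem sum_smul_conv_sum_smul {μ ν : ℕ → Measure ℝ} [∀ n, SFinite (ν n)] (f g : ℕ → ENNReal) :
    (sum fun n => f n • μ n).conv (sum fun n => g n • ν n)
      = sum fun p : ℕ × ℕ => (f p.1 * g p.2) • (μ p.1).conv (ν p.2) := by
  rw [conv, prod_sum, map_sum (by fun_prop)]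
  congr 1
  funext p
  rw [prod_smul_left, prod_smul_right, Measure.map_smul, Measure.map_smul, smul_smul, conv]

end MeasureTheory.Measure

instance convPow.instSFinite (μ : Measure ℝ) [SFinite μ] (n : ℕ) : SFinite (convPow μ n) := by
  induction n with
  | zero => rw [convPow]; infer_instance
  | succ n ih => rw [convPow]; infer_instance

instance convPow.instIsProbabilityMeasure (μ : Measure ℝ) [IsProbabilityMeasure μ] (n : ℕ) :
    IsProbabilityMeasure (convPow μ n) := by
  induction n with
  | zero => rw [convPow]; infer_instance
  | succ n ih => rw [convPow]; infer_instance

theorem convPow_one (μ : Measure ℝ) [SFinite μ] : convPow μ 1 = μ := by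
  rw [convPow, convPow, Measure.dirac_zero_conv]

theorem convPow_add (μ : Measure ℝ) [SFinite μ] (i j : ℕ) :
    convPow μ (i + j) = (convPow μ i).conv (convPow μ j) := by
  induction j with
  | zero => rw [add_zero, convPow, Measure.conv_dirac_zero]
  | succ j ih => rw [← add_assoc, convPow, convPow, ih, Measure.conv_assoc]

theorem convPow_univ (μ : Measure ℝ) [SFinite μ] (n : ℕ) :
    convPow μ n Set.univ = μ Set.univ ^ n := by
  induction n with
  | zero => simp [convPow]
  | succ n ih =>
    rw [convPow, Measure.conv, Measure.map_apply (by fun_prop) MeasurableSet.univ, Set.preimage_univ,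
      ← Set.univ_prod_univ, Measure.prod_prod, ih, pow_succ]

theorem PowerSeries.coeff_pow_nonneg {F : PowerSeries ℝ} (hF : ∀ n, 0 ≤ coeff n F) (k n : ℕ) :
    0 ≤ coeff n (F ^ k) := by
  rw [coeff_pow]
  exact Finset.sum_nonneg fun l _ => Finset.prod_nonneg fun i _ => hF _

/-- Convolution powers of a mixture of convolution powers, with the mixing weights given by the
coefficients of a power series. -/
theorem convPow_sum_smul_convPow (μ₀ : Measure ℝ) [SFinite μ₀] (p : ℕ) {F : PowerSeries ℝ}
    (hF : ∀ n, 0 ≤ PowerSeries.coeff n F) (k : ℕ) :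
    convPow (Measure.sum fun n => ENNReal.ofReal (PowerSeries.coeff n F) • convPow μ₀ (p * n + 1)) k
      = Measure.sum fun n =>
          ENNReal.ofReal (PowerSeries.coeff n (F ^ k)) • convPow μ₀ (p * n + k) := by
  induction k with
  | zero =>
    ext A hA
    rw [Measure.sum_apply _ hA, tsum_eq_single 0]
    · simp [convPow]
    · intro n hn
      simp [PowerSeries.coeff_one, hn]
  | succ k ih =>
    rw [convPow, ih, Measure.sum_smul_conv_sum_smul]
    ext A hA
    rw [Measure.sum_apply _ hA, Measure.sum_apply _ hA,
      ← Finset.HasAntidiagonal.sigmaAntidiagonalEquivProd.tsum_eq, ENNReal.tsum_sigma']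
    refine tsum_congr fun n => ?_
    rw [tsum_fintype, Finset.sum_coe_sort_eq_attach, pow_succ, PowerSeries.coeff_mul,
      ENNReal.ofReal_sum_of_nonneg fun q _ =>
        mul_nonneg (PowerSeries.coeff_pow_nonneg hF _ _) (hF _),
      Measure.smul_apply, smul_eq_mul, Finset.sum_mul]
    refine Eq.trans ?_ (Finset.sum_attach _ _)
    refine Finset.sum_congr rfl fun q _ => ?_
    have hq : q.1.1 + q.1.2 = n := Finset.HasAntidiagonal.mem_antidiagonal.1 q.2
    simp only [Finset.HasAntidiagonal.sigmaAntidiagonalEquivProd_apply, Measure.smul_apply,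
      smul_eq_mul]
    have hexp : p * q.1.1 + k + (p * q.1.2 + 1) = p * n + (k + 1) := by
      linear_combination p * hq
    rw [← convPow_add, ENNReal.ofReal_mul (PowerSeries.coeff_pow_nonneg hF _ _), hexp]

/-- The weights of the Wild sum at time `t`, as a power series; `B` is the generating series of the
time-independent coefficients. -/
noncomputable def wildWeights (p : ℕ) (lam : ℝ) (B : PowerSeries ℝ) (t : ℝ) : PowerSeries ℝ :=
  PowerSeries.C (Real.exp (-(lam * t))) *
    PowerSeries.rescale (1 - Real.exp (-(p * lam * t))) B

/-- The Wild sum at time `t` started at `μ₀`. -/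
noncomputable def wildSum (p : ℕ) (lam : ℝ) (B : PowerSeries ℝ) (μ₀ : Measure ℝ) (t : ℝ) :
    Measure ℝ :=
  Measure.sum fun n =>
    ENNReal.ofReal (PowerSeries.coeff n (wildWeights p lam B t)) • convPow μ₀ (p * n + 1)

instance wildSum.instSFinite (p : ℕ) (lam : ℝ) (B : PowerSeries ℝ) (μ₀ : Measure ℝ) [SFinite μ₀]
    (t : ℝ) : SFinite (wildSum p lam B μ₀ t) := by
  unfold wildSum
  infer_instance

theorem coeff_wildWeights_pow (p : ℕ) (lam : ℝ) (B : PowerSeries ℝ) (t : ℝ) (k n : ℕ) :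
    PowerSeries.coeff n (wildWeights p lam B t ^ k) = Real.exp (-(lam * t)) ^ k *
      (PowerSeries.coeff n (B ^ k) * (1 - Real.exp (-(p * lam * t))) ^ n) := by
  rw [wildWeights, mul_pow, ← map_pow, ← map_pow, PowerSeries.coeff_C_mul,
    PowerSeries.coeff_rescale]
  ring

theorem one_sub_exp_neg_mem_Ico {p : ℕ} {lam t : ℝ} (hlam : 0 ≤ lam) (ht : 0 ≤ t) :
    1 - Real.exp (-(p * lam * t)) ∈ Set.Ico (0 : ℝ) 1 := by
  have h1 : Real.exp (-(p * lam * t)) ≤ 1 :=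
    Real.exp_le_one_iff.2 (neg_nonpos.2 (by positivity))
  have h2 := Real.exp_pos (-(p * lam * t))
  exact ⟨by linarith, by linarith⟩

section

variable {p : ℕ} {lam : ℝ} {B : PowerSeries ℝ} {μ₀ : Measure ℝ} [IsProbabilityMeasure μ₀] {t : ℝ}

theorem convPow_wildSum_toReal (hlam : 0 ≤ lam) (hB : ∀ n, 0 ≤ PowerSeries.coeff n B) (ht : 0 ≤ t)
    (k : ℕ) {A : Set ℝ} (hA : MeasurableSet A) :
    (convPow (wildSum p lam B μ₀ t) k A).toReal = Real.exp (-(lam * t)) ^ k *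
      ∑' n, PowerSeries.coeff n (B ^ k) * (convPow μ₀ (p * n + k) A).toReal *
        (1 - Real.exp (-(p * lam * t))) ^ n := by
  have hz := (one_sub_exp_neg_mem_Ico (p := p) hlam ht).1
  have hF (k n : ℕ) : 0 ≤ PowerSeries.coeff n (wildWeights p lam B t ^ k) := by
    have := PowerSeries.coeff_pow_nonneg hB k n
    rw [coeff_wildWeights_pow]
    positivity
  rw [wildSum, convPow_sum_smul_convPow μ₀ p fun n => by simpa using hF 1 n,
    Measure.sum_apply _ hA]
  simp only [Measure.smul_apply, smul_eq_mul]
  rw [ENNReal.tsum_toReal_eq fun n => ENNReal.mul_ne_top ENNReal.ofReal_ne_top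
    (measure_ne_top _ _), ← tsum_mul_left]
  refine tsum_congr fun n => ?_
  rw [ENNReal.toReal_mul, ENNReal.toReal_ofReal (hF k n), coeff_wildWeights_pow]
  ring

theorem wildSum_toReal (hlam : 0 ≤ lam) (hB : ∀ n, 0 ≤ PowerSeries.coeff n B) (ht : 0 ≤ t)
    {A : Set ℝ} (hA : MeasurableSet A) :
    (wildSum p lam B μ₀ t A).toReal = Real.exp (-(lam * t)) *
      ∑' n, PowerSeries.coeff n B * (convPow μ₀ (p * n + 1) A).toReal *
        (1 - Real.exp (-(p * lam * t))) ^ n := by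
  have h := convPow_wildSum_toReal (p := p) (μ₀ := μ₀) hlam hB ht 1 hA
  rwa [convPow_one, pow_one, pow_one] at h

theorem isProbabilityMeasure_wildSum (hlam : 0 ≤ lam) (hp : p ≠ 0) (hBp : B ^ p = PowerSeries.mk 1)
    (hB : ∀ n, 0 ≤ PowerSeries.coeff n B) (ht : 0 ≤ t) :
    IsProbabilityMeasure (wildSum p lam B μ₀ t) := by
  have hz := one_sub_exp_neg_mem_Ico (p := p) hlam ht
  have h := convPow_wildSum_toReal (p := p) (μ₀ := μ₀) hlam hB ht p MeasurableSet.univ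
  simp only [hBp, PowerSeries.coeff_mk, Pi.one_apply, measure_univ, ENNReal.toReal_one,
    one_mul] at h
  rw [tsum_geometric_of_lt_one hz.1 hz.2, sub_sub_cancel, ← Real.exp_nat_mul, ← Real.exp_neg,
    ← Real.exp_add, show (p : ℝ) * -(lam * t) + - -(p * lam * t) = 0 by ring, Real.exp_zero,
    convPow_univ, ENNReal.toReal_pow, pow_eq_one_iff_of_nonneg ENNReal.toReal_nonneg hp,
    ENNReal.toReal_eq_one_iff] at h
  exact ⟨h⟩

theorem wildSum_toReal_eq_add_integral (hlam : 0 ≤ lam) (hp : p ≠ 0)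
    (hBp : B ^ p = PowerSeries.mk 1) (hB0 : PowerSeries.coeff 0 B = 1) (ht : 0 ≤ t)
    {A : Set ℝ} (hA : MeasurableSet A) :
    (wildSum p lam B μ₀ t A).toReal = (μ₀ A).toReal + lam * ∫ s in (0 : ℝ)..t,
      (convPow (wildSum p lam B μ₀ s) (p + 1) A).toReal - (wildSum p lam B μ₀ s A).toReal := by
  have hB := PowerSeries.coeff_mem_Icc_of_pow_eq_mk_one hp hBp hB0
  set z : ℝ → ℝ := fun s => 1 - Real.exp (-(p * lam * s)) with hz_def
  have hz {s : ℝ} (hs : 0 ≤ s) : |z s| < 1 := by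
    have := one_sub_exp_neg_mem_Ico (p := p) hlam hs
    rw [abs_of_nonneg this.1]
    exact this.2
  have hr (n : ℕ) : (convPow μ₀ n A).toReal ∈ Set.Icc (0 : ℝ) 1 :=
    ⟨ENNReal.toReal_nonneg, ENNReal.toReal_mono ENNReal.one_ne_top prob_le_one⟩
  set a : ℕ → ℝ := fun n => PowerSeries.coeff n B * (convPow μ₀ (p * n + 1) A).toReal with ha_def
  have ha (n : ℕ) : |a n| ≤ 1 := by
    rw [abs_of_nonneg (mul_nonneg (hB n).1 (hr _).1)]
    exact mul_le_one₀ (hB n).2 (hr _).1 (hr _).2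
  have hg {y : ℝ} (hy : |y| < 1) := hasDerivAt_tsum_mul_pow (k := 0) (fun n => by simpa using ha n) hy
  have hG {y : ℝ} (hy : |y| < 1) := hasDerivAt_tsum_mul_pow (a := fun n => (n + 1) * a (n + 1))
    (k := 1) (fun n => by
      have hn : (0 : ℝ) ≤ n + 1 := by positivity
      rw [abs_mul, abs_of_nonneg hn, pow_one]
      exact mul_le_of_le_one_right hn (ha _)) hy
  set g : ℝ → ℝ := fun y => ∑' n, a n * y ^ n with hg_def
  set G : ℝ → ℝ := fun y => ∑' n : ℕ, (n + 1) * a (n + 1) * y ^ n with hG_def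
  have hz' (s : ℝ) : HasDerivAt z (Real.exp (-(p * lam * s)) * (p * lam)) s := by
    have h := (((hasDerivAt_id s).const_mul (p * lam)).neg.exp).const_sub 1
    refine h.congr_deriv ?_
    simp
  have hE (s : ℝ) : HasDerivAt (fun s => Real.exp (-(lam * s)))
      (Real.exp (-(lam * s)) * -lam) s := by
    refine (((hasDerivAt_id s).const_mul lam).neg.exp).congr_deriv ?_
    simp
  have hconv {s : ℝ} (hs : 0 ≤ s) : (convPow (wildSum p lam B μ₀ s) (p + 1) A).toReal
      = Real.exp (-(lam * s)) * (Real.exp (-(p * lam * s)) * p) * G (z s) := by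
    have hsum : ∑' n, PowerSeries.coeff n (B ^ (p + 1)) * (convPow μ₀ (p * n + (p + 1)) A).toReal *
        (1 - Real.exp (-(p * lam * s))) ^ n = p * G (z s) := by
      simp only [hG_def]
      rw [← tsum_mul_left]
      refine tsum_congr fun n => ?_
      rw [← (PowerSeries.natCast_mul_coeff_succ_of_pow_eq_mk_one hp hBp n).1,
        show p * n + (p + 1) = p * (n + 1) + 1 by ring]
      simp only [ha_def, hz_def]
      ring
    rw [convPow_wildSum_toReal hlam (fun n => (hB n).1) hs _ hA, hsum, pow_succ',
      ← Real.exp_nat_mul, show (p : ℝ) * -(lam * s) = -(p * lam * s) by ring]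
    ring
  have hwild {s : ℝ} (hs : 0 ≤ s) :
      (wildSum p lam B μ₀ s A).toReal = Real.exp (-(lam * s)) * g (z s) :=
    wildSum_toReal hlam (fun n => (hB n).1) hs hA
  have hnonneg {s : ℝ} (hs : s ∈ Set.uIcc 0 t) : 0 ≤ s := by
    rw [Set.uIcc_of_le ht] at hs
    exact hs.1
  have hderiv (s : ℝ) (hs : s ∈ Set.uIcc 0 t) :
      HasDerivAt (fun s => Real.exp (-(lam * s)) * g (z s))
        (lam * (Real.exp (-(lam * s)) * (Real.exp (-(p * lam * s)) * p) * G (z s)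
          - Real.exp (-(lam * s)) * g (z s))) s := by
    refine ((hE s).mul ((hg (hz (hnonneg hs))).comp s (hz' s))).congr_deriv ?_
    simp only [Function.comp_apply]
    ring
  have hcont : ContinuousOn (fun s => lam * (Real.exp (-(lam * s)) *
      (Real.exp (-(p * lam * s)) * p) * G (z s) - Real.exp (-(lam * s)) * g (z s)))
      (Set.uIcc 0 t) := by
    intro s hs
    have h1 : ContinuousAt (fun s => G (z s)) s :=
      ((hG (hz (hnonneg hs))).comp s (hz' s)).continuousAt
    have h2 : ContinuousAt (fun s => g (z s)) s :=
      ((hg (hz (hnonneg hs))).comp s (hz' s)).continuousAt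
    have h3 : ContinuousAt (fun s => Real.exp (-(lam * s))) s := (hE s).continuousAt
    have h4 : ContinuousAt (fun s => Real.exp (-(p * lam * s)) * (p : ℝ)) s := by fun_prop
    exact (continuousAt_const.mul (((h3.mul h4).mul h1).sub (h3.mul h2))).continuousWithinAt
  have hFTC := intervalIntegral.integral_eq_sub_of_hasDerivAt hderiv hcont.intervalIntegrable
  have hzero : Real.exp (-(lam * 0)) * g (z 0) = (μ₀ A).toReal := by
    simp only [hg_def, hz_def, mul_zero, neg_zero, Real.exp_zero, one_mul, sub_self]
    rw [tsum_eq_single 0 fun n hn => by simp [hn]]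
    simp [ha_def, hB0, convPow_one]
  rw [hzero, intervalIntegral.integral_const_mul] at hFTC
  rw [hwild ht, intervalIntegral.integral_congr (g := fun s => Real.exp (-(lam * s)) *
    (Real.exp (-(p * lam * s)) * p) * G (z s) - Real.exp (-(lam * s)) * g (z s)) fun s hs => by
      simp only [hconv (hnonneg hs), hwild (hnonneg hs)], hFTC]
  ring

end

/-- **Proposition 3, existence.** For the `m`-agent model, the Wild sum
`μ_t = Σ_{n≥1} b(n) e^{−λt}(1−e^{−(m−1)λt})^{n−1} μ₀^{*[(m−1)(n−1)+1]}` is, for each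
`t ≥ 0`, a Borel probability measure on `ℝ`, and it satisfies the evolution equation
`μ_t(A) = μ₀(A) + λ ∫₀ᵗ (μ_s^{*m}(A) − μ_s(A)) ds` for every Borel set `A`. -/
theorem wildSum_m_isProbability_and_solves_evolution
    (m : ℕ) (hm : 2 ≤ m) (lam : ℝ) (hlam : 0 < lam)
    (μ₀ : Measure ℝ) [IsProbabilityMeasure μ₀]
    (hmgf : ∃ ε > (0 : ℝ), ∀ s : ℝ, |s| < ε → Integrable (fun x : ℝ => Real.exp (s * x)) μ₀)
    (hmean : ∫ x, x ∂μ₀ ≠ 0)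
    (b : ℕ → ℝ)
    (hb1 : b 1 = 1)
    (hbrec : ∀ n > 1, b n =
      ((m : ℝ) - 1)⁻¹ *
        (1 - ∑ i ∈ (Fintype.piFinset fun _ : Fin (m - 1) => Finset.Ico 1 n).filter
              (fun i => ∑ k, i k = n + m - 2),
            ∏ k, b (i k))) :
    ∃ μ : ℝ → Measure ℝ,
      (∀ t ≥ (0 : ℝ), IsProbabilityMeasure (μ t)) ∧
      (∀ t ≥ (0 : ℝ), ∀ A : Set ℝ, MeasurableSet A →
        ((μ t) A).toReal = ∑' n : ℕ,
          b (n + 1) * Real.exp (-(lam * t)) *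
              (1 - Real.exp (-((m - 1 : ℕ) * lam * t))) ^ n *
            ((convPow μ₀ ((m - 1) * n + 1)) A).toReal) ∧
      (∀ t ≥ (0 : ℝ), ∀ A : Set ℝ, MeasurableSet A →
        ((μ t) A).toReal =
          (μ₀ A).toReal +
            lam * ∫ s in (0 : ℝ)..t,
              ((convPow (μ s) m) A).toReal - ((μ s) A).toReal) := by
  obtain ⟨p, rfl⟩ : ∃ p, m = p + 1 := ⟨m - 1, by lia⟩
  have hp : p ≠ 0 := by lia
  have hb : ∀ n > 1, b n = (p : ℝ)⁻¹ *
      (1 - ∑ i ∈ (Fintype.piFinset fun _ : Fin p => Finset.Ico 1 n).filter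
            (fun i => ∑ k, i k = n + p - 1), ∏ k, b (i k)) := by
    intro n hn
    have h := hbrec n hn
    rw [show ((p + 1 : ℕ) : ℝ) - 1 = p by push_cast; ring] at h
    exact h
  have hBp := PowerSeries.mk_pow_eq_mk_one_of_recurrence hp hb1 hb
  have hB0 : PowerSeries.coeff 0 (PowerSeries.mk fun n => b (n + 1)) = 1 := by simp [hb1]
  have hB n := (PowerSeries.coeff_mem_Icc_of_pow_eq_mk_one hp hBp hB0 n).1
  refine ⟨wildSum p lam (PowerSeries.mk fun n => b (n + 1)) μ₀,
    fun t ht => isProbabilityMeasure_wildSum hlam.le hp hBp hB ht, fun t ht A hA => ?_,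
    fun t ht A hA => wildSum_toReal_eq_add_integral hlam.le hp hBp hB0 ht hA⟩
  rw [wildSum_toReal hlam.le hB ht hA, ← tsum_mul_left]
  refine tsum_congr fun n => ?_
  rw [PowerSeries.coeff_mk, Nat.add_sub_cancel]
  ring
end

section
/- (Proposition 3, uniqueness.) Fix an integer m ≥ 2, λ > 0, and a Borel probability measure μ₀ on ℝ whose moment generating function s ↦ ∫ e^{s x} dμ₀(x) is finite on a neighborhood of 0 and which has nonzero first moment ∫ x dμ₀(x) ≠ 0. Suppose (μ_t)_{t≥0} and (ν_t)_{t≥0} are two families of Borel probability measures on ℝ with μ_0 = ν_0 = μ₀ such that for every Borel set A ⊆ ℝ the functions t ↦ μ_t(A) and t ↦ ν_t(A) are measurable and both families satisfy μ_t(A) = μ₀(A) + λ ∫₀ᵗ ( μ_s^{*m}(A) − μ_s(A) ) ds for all t ≥ 0 and all Borel A. Then μ_t = ν_t for every t ≥ 0. -/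
open MeasureTheory

instance isProbabilityMeasure_convPow (μ : Measure ℝ) [IsProbabilityMeasure μ] (n : ℕ) :
    IsProbabilityMeasure (convPow μ n) := by
  induction n with
  | zero => unfold convPow; infer_instance
  | succ n ih => unfold convPow; infer_instance

theorem MeasureTheory.Measure.conv_real_apply (ρ μ : Measure ℝ) [IsProbabilityMeasure ρ]
    [IsProbabilityMeasure μ] {A : Set ℝ} (hA : MeasurableSet A) :
    (ρ.conv μ).real A = ∫ y, ρ.real ((fun x => x + y) ⁻¹' A) ∂μ := by
  rw [measureReal_def, Measure.conv, Measure.map_apply (by fun_prop) hA,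
    Measure.prod_apply_symm (hA.preimage (by fun_prop)), integral_eq_lintegral_of_nonneg_ae
      (Filter.Eventually.of_forall fun _ => measureReal_nonneg)]
  · simp only [measureReal_def, ENNReal.ofReal_toReal (measure_ne_top _ _)]
    rfl
  · exact (measurable_measure_prodMk_right (μ := ρ) (s := (fun p : ℝ × ℝ => p.1 + p.2) ⁻¹' A)
      (hA.preimage (by fun_prop))).ennreal_toReal.aestronglyMeasurable

theorem MeasureTheory.Measure.integrable_real_preimage_add (ρ μ : Measure ℝ)
    [IsProbabilityMeasure ρ] [IsProbabilityMeasure μ] {A : Set ℝ} (hA : MeasurableSet A) :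
    Integrable (fun y => ρ.real ((fun x => x + y) ⁻¹' A)) μ := by
  refine Integrable.of_bound (C := 1) (measurable_measure_prodMk_right (μ := ρ)
    (s := (fun p : ℝ × ℝ => p.1 + p.2) ⁻¹' A)
      (hA.preimage (by fun_prop))).ennreal_toReal.aestronglyMeasurable ?_
  refine Filter.Eventually.of_forall fun y => ?_
  rw [Real.norm_of_nonneg measureReal_nonneg]
  exact measureReal_le_one

/-- Convolving with a probability measure does not increase the distance in total variation. -/
theorem MeasureTheory.Measure.abs_conv_real_sub_le (ρ σ μ : Measure ℝ) [IsProbabilityMeasure ρ]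
    [IsProbabilityMeasure σ] [IsProbabilityMeasure μ] {c : ℝ}
    (h : ∀ A, MeasurableSet A → |ρ.real A - σ.real A| ≤ c) {A : Set ℝ} (hA : MeasurableSet A) :
    |(ρ.conv μ).real A - (σ.conv μ).real A| ≤ c := by
  rw [conv_real_apply ρ μ hA, conv_real_apply σ μ hA,
    ← integral_sub (integrable_real_preimage_add ρ μ hA) (integrable_real_preimage_add σ μ hA)]
  have hbound (y : ℝ) : ‖ρ.real ((fun x => x + y) ⁻¹' A) - σ.real ((fun x => x + y) ⁻¹' A)‖ ≤ c :=
    h _ (hA.preimage (by fun_prop))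
  simpa using norm_integral_le_of_norm_le_const (μ := μ) (Filter.Eventually.of_forall hbound)

theorem abs_convPow_real_sub_le (μ ν : Measure ℝ) [IsProbabilityMeasure μ]
    [IsProbabilityMeasure ν] {c : ℝ} (h : ∀ A, MeasurableSet A → |μ.real A - ν.real A| ≤ c)
    (n : ℕ) : ∀ A, MeasurableSet A →
      |(convPow μ n).real A - (convPow ν n).real A| ≤ n * c := by
  induction n with
  | zero => intro A _; simp [convPow]
  | succ n ih =>
    intro A hA
    have h₁ := Measure.abs_conv_real_sub_le (convPow μ n) (convPow ν n) μ ih hA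
    have h₂ := Measure.abs_conv_real_sub_le μ ν (convPow ν n) h hA
    rw [Measure.conv_comm μ, Measure.conv_comm ν] at h₂
    calc _ ≤ _ := abs_sub_le _ (((convPow ν n).conv μ).real A) _
      _ ≤ n * c + c := add_le_add h₁ h₂
      _ = _ := by push_cast; ring

open ProbabilityTheory in
theorem MeasureTheory.Measure.measurable_conv {κ η : ℝ → Measure ℝ} (hκ : Measurable κ) (hη : Measurable η)
    [∀ s, IsProbabilityMeasure (κ s)] [∀ s, IsProbabilityMeasure (η s)] :
    Measurable fun s => (κ s).conv (η s) := by
  let K : Kernel ℝ ℝ := ⟨κ, hκ⟩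
  let H : Kernel ℝ ℝ := ⟨η, hη⟩
  have : IsMarkovKernel K := ⟨fun s => inferInstanceAs (IsProbabilityMeasure (κ s))⟩
  have : IsMarkovKernel H := ⟨fun s => inferInstanceAs (IsProbabilityMeasure (η s))⟩
  convert! ((K ×ₖ H).map fun p : ℝ × ℝ => p.1 + p.2).measurable using 2 with s
  rw [Kernel.map_apply _ (by fun_prop), Kernel.prod_apply]
  rfl

theorem measurable_convPow {κ : ℝ → Measure ℝ} (hκ : Measurable κ)
    [∀ s, IsProbabilityMeasure (κ s)] (n : ℕ) : Measurable fun s => convPow (κ s) n := by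
  induction n with
  | zero => exact measurable_const
  | succ n ih => exact Measure.measurable_conv ih hκ

theorem intervalIntegrable_convPow_sub {μ : ℝ → Measure ℝ}
    (hprob : ∀ t ≥ (0 : ℝ), IsProbabilityMeasure (μ t))
    (hmeas : ∀ A : Set ℝ, MeasurableSet A → Measurable fun t : ℝ => (μ t) A) (m : ℕ)
    {A : Set ℝ} (hA : MeasurableSet A) {t : ℝ} (ht : 0 ≤ t) :
    IntervalIntegrable (fun s => (convPow (μ s) m).real A - (μ s).real A) volume 0 t := by
  let κ : ℝ → Measure ℝ := fun s => μ (max s 0)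
  have : ∀ s, IsProbabilityMeasure (κ s) := fun s => hprob _ (le_max_right _ _)
  have hκ : Measurable κ :=
    (Measure.measurable_of_measurable_coe μ hmeas).comp (by fun_prop)
  have hmeas' : Measurable fun s => (convPow (κ s) m).real A - (κ s).real A :=
    ((Measure.measurable_coe hA).comp (measurable_convPow hκ m)).ennreal_toReal.sub
      ((Measure.measurable_coe hA).comp hκ).ennreal_toReal
  have hint : IntervalIntegrable (fun s => (convPow (κ s) m).real A - (κ s).real A)
      volume 0 t := by
    refine (intervalIntegrable_const (c := (1 : ℝ))).mono_fun hmeas'.aestronglyMeasurable ?_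
    refine Filter.Eventually.of_forall fun s => ?_
    simpa using abs_sub_le_of_nonneg_of_le measureReal_nonneg measureReal_le_one
      measureReal_nonneg measureReal_le_one
  refine hint.congr fun s hs => ?_
  rw [Set.uIoc_of_le ht] at hs
  simp [κ, max_eq_left hs.1.le]

/-- **Proposition 3, uniqueness.** If `μ₀` is a Borel probability measure
on `ℝ` with moment generating function finite near `0` and nonzero first moment, then
two measurable families of probability measures starting at `μ₀` and both satisfying the
`m`-agent evolution equation `μ_t(A) = μ₀(A) + λ ∫₀ᵗ (μ_s^{*m}(A) − μ_s(A)) ds`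
coincide. -/
theorem evolution_m_solution_unique
    (m : ℕ) (hm : 2 ≤ m) (lam : ℝ) (hlam : 0 < lam)
    (μ₀ : Measure ℝ) [IsProbabilityMeasure μ₀]
    (hmgf : ∃ ε > (0 : ℝ), ∀ s : ℝ, |s| < ε → Integrable (fun x : ℝ => Real.exp (s * x)) μ₀)
    (hmean : ∫ x, x ∂μ₀ ≠ 0)
    (μ ν : ℝ → Measure ℝ)
    (hμprob : ∀ t ≥ (0 : ℝ), IsProbabilityMeasure (μ t))
    (hνprob : ∀ t ≥ (0 : ℝ), IsProbabilityMeasure (ν t))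
    (hμ0 : μ 0 = μ₀) (hν0 : ν 0 = μ₀)
    (hμmeas : ∀ A : Set ℝ, MeasurableSet A → Measurable fun t : ℝ => (μ t) A)
    (hνmeas : ∀ A : Set ℝ, MeasurableSet A → Measurable fun t : ℝ => (ν t) A)
    (hμeq : ∀ A : Set ℝ, MeasurableSet A → ∀ t ≥ (0 : ℝ),
      ((μ t) A).toReal =
        (μ₀ A).toReal +
          lam * ∫ s in (0 : ℝ)..t, ((convPow (μ s) m) A).toReal - ((μ s) A).toReal)
    (hνeq : ∀ A : Set ℝ, MeasurableSet A → ∀ t ≥ (0 : ℝ),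
      ((ν t) A).toReal =
        (μ₀ A).toReal +
          lam * ∫ s in (0 : ℝ)..t, ((convPow (ν s) m) A).toReal - ((ν s) A).toReal) :
    ∀ t ≥ (0 : ℝ), μ t = ν t := by
  have bound : ∀ n : ℕ, ∀ t ≥ (0 : ℝ), ∀ A, MeasurableSet A →
      |(μ t).real A - (ν t).real A| ≤ (lam * (m + 1) * t) ^ n / n.factorial := by
    intro n
    induction n with
    | zero =>
      intro t ht A _
      have := hμprob t ht
      have := hνprob t ht
      simpa using abs_sub_le_of_nonneg_of_le measureReal_nonneg measureReal_le_one
        measureReal_nonneg measureReal_le_one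
    | succ n ih =>
      intro t ht A hA
      have hf := intervalIntegrable_convPow_sub hμprob hμmeas m hA ht
      have hg := intervalIntegrable_convPow_sub hνprob hνmeas m hA ht
      have hdiff : (μ t).real A - (ν t).real A = lam * ∫ s in (0 : ℝ)..t,
          (((convPow (μ s) m).real A - (μ s).real A) -
            ((convPow (ν s) m).real A - (ν s).real A)) := by
        rw [intervalIntegral.integral_sub hf hg]
        have h₁ := hμeq A hA t ht
        have h₂ := hνeq A hA t ht
        simp only [measureReal_def]
        linarith
      have hle := intervalIntegral.norm_integral_le_of_norm_le (μ := volume) ht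
        (f := fun s => ((convPow (μ s) m).real A - (μ s).real A) -
            ((convPow (ν s) m).real A - (ν s).real A))
        (g := fun s => (m + 1) * ((lam * (m + 1) * s) ^ n / n.factorial))
        (Filter.Eventually.of_forall fun s hs => by
          have := hμprob s hs.1.le
          have := hνprob s hs.1.le
          have h₁ := abs_convPow_real_sub_le (μ s) (ν s) (ih s hs.1.le) m A hA
          have h₂ := ih s hs.1.le A hA
          rw [Real.norm_eq_abs, sub_sub_sub_comm, add_one_mul]
          exact (abs_sub _ _).trans (add_le_add h₁ h₂))
        (Continuous.intervalIntegrable (by fun_prop) _ _)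
      have hval : ∫ s in (0 : ℝ)..t, ((m : ℝ) + 1) * ((lam * (m + 1) * s) ^ n / n.factorial) =
          (m + 1) * ((lam * (m + 1)) ^ n / n.factorial * (t ^ (n + 1) / (n + 1))) := by
        simp_rw [mul_pow _ _ n, mul_div_right_comm _ _ (n.factorial : ℝ)]
        rw [intervalIntegral.integral_const_mul, intervalIntegral.integral_const_mul,
          integral_pow]
        simp
      rw [hdiff, abs_mul, abs_of_pos hlam]
      rw [hval, Real.norm_eq_abs] at hle
      refine (mul_le_mul_of_nonneg_left hle hlam.le).trans_eq ?_
      rw [Nat.factorial_succ, mul_pow _ t]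
      push_cast
      field_simp
      ring
  intro t ht
  have := hμprob t ht
  have := hνprob t ht
  refine Measure.ext fun A hA => ?_
  have hzero : |(μ t).real A - (ν t).real A| ≤ 0 :=
    ge_of_tendsto' (FloorSemiring.tendsto_pow_div_factorial_atTop _) fun n => bound n t ht A hA
  rw [← measureReal_eq_measureReal_iff]
  exact sub_eq_zero.mp (abs_nonpos_iff.mp hzero)
end
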